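/- Assume the Setting. Then for every x, y ∈ L with y ≠ x such that C_y = p + C_x for some p ∈ ℝ^n, the grazes Ω_x = C_x ∩ bd K and Ω_y = C_y ∩ bd K are inversely homothetic with ratio of homothety equal to −1; that is, there exists c ∈ ℝ^n such that Ω_y = {2c − z : z ∈ Ω_x}. -/

import Mathlib

open Set Metric RealInnerProductSpace

noncomputable section

/-- Euclidean space ℝ^n. -/
abbrev Euc (n : ℕ) := EuclideanSpace ℝ (Fin n)

/-- The solid double-cone generated by a convex body `K` and a point `x`:
the union of all lines through `x` and a point of `K`. -/
def solidCone {n : ℕ} (K : Set (Euc n)) (x : Euc n) : Set (Euc n) :=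
  ⋃ y ∈ K, (affineSpan ℝ ({x, y} : Set (Euc n)) : Set (Euc n))

/-- The support double-cone of `K` with apex `x`: the topological frontier of
the solid double-cone. -/
def supportCone {n : ℕ} (K : Set (Euc n)) (x : Euc n) : Set (Euc n) :=
  frontier (solidCone K x)

/-- A convex body: a compact convex set with nonempty interior. -/
def IsConvexBody {n : ℕ} (K : Set (Euc n)) : Prop :=
  IsCompact K ∧ Convex ℝ K ∧ (interior K).Nonempty

/-- `M` is the image of a topological embedding of the sphere `S^m ⊆ ℝ^(m+1)`
into ℝ^n: a continuous injective map from the unit sphere with range `M`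
(such a map from the compact sphere is automatically a homeomorphism onto its
image). -/
def IsSphereEmbeddingImage {n : ℕ} (m : ℕ) (M : Set (Euc n)) : Prop :=
  ∃ f : Metric.sphere (0 : Euc (m + 1)) 1 → Euc n,
    Continuous f ∧ Function.Injective f ∧ Set.range f = M

def DC {n : ℕ} (K : Set (Euc n)) (x : Euc n) : Set (Euc n) :=
  {e | ∃ s : ℝ, 0 ≤ s ∧ ∃ k ∈ K, e = s • (k - x)}

def EC {n : ℕ} (K : Set (Euc n)) (x : Euc n) : Set (Euc n) :=
  {e | ∃ s : ℝ, ∃ k ∈ K, e = s • (k - x)}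

lemma mem_solid {n : ℕ} (K : Set (Euc n)) (x e : Euc n) :
    x + e ∈ solidCone K x ↔ e ∈ EC K x := by
  simp only [solidCone, EC, mem_iUnion, mem_ofPred_eq, SetLike.mem_coe,
    mem_affineSpan_pair_iff_exists_lineMap_eq, AffineMap.lineMap_apply, vsub_eq_sub, vadd_eq_add]
  constructor
  · rintro ⟨k, hk, r, h⟩
    refine ⟨r, k, hk, ?_⟩
    rw [add_comm] at h
    exact (add_left_cancel h).symm
  · rintro ⟨r, k, hk, h⟩
    exact ⟨k, hk, r, by rw [h, add_comm]⟩

lemma mem_front {n : ℕ} (K : Set (Euc n)) (x e : Euc n) :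
    x + e ∈ supportCone K x ↔ e ∈ frontier (EC K x) := by
  have h1 : EC K x = (Homeomorph.addLeft x) ⁻¹' (solidCone K x) := by
    ext e
    simp [mem_solid]
  rw [h1, ← Homeomorph.preimage_frontier]
  simp [supportCone]

lemma EC_iff {n : ℕ} (K : Set (Euc n)) (x e : Euc n) :
    e ∈ EC K x ↔ e ∈ DC K x ∨ -e ∈ DC K x := by
  constructor
  · rintro ⟨s, k, hk, h⟩
    rcases le_total 0 s with hs | hs
    · exact Or.inl ⟨s, hs, k, hk, h⟩
    · exact Or.inr ⟨-s, by linarith, k, hk, by rw [h, neg_smul]⟩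
  · rintro (⟨s, hs, k, hk, h⟩ | ⟨s, hs, k, hk, h⟩)
    · exact ⟨s, k, hk, h⟩
    · exact ⟨-s, k, hk, by rw [neg_smul, ← h, neg_neg]⟩

lemma exists_f {n : ℕ} (K : Set (Euc n)) (hK : IsCompact K) (hc : Convex ℝ K) (x : Euc n)
    (hx : x ∉ K) : ∃ f : Euc n, ∀ k ∈ K, 0 < ⟪f, k - x⟫ := by
  obtain ⟨f, u, h1, h2⟩ := geometric_hahn_banach_point_closed hc hK.isClosed hx
  refine ⟨(InnerProductSpace.toDual ℝ (Euc n)).symm f, fun k hk => ?_⟩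
  rw [InnerProductSpace.toDual_symm_apply, map_sub]
  have := h2 k hk
  linarith

lemma DC_pos {n : ℕ} {K : Set (Euc n)} {x f e : Euc n} (hf : ∀ k ∈ K, 0 < ⟪f, k - x⟫)
    (he : e ∈ DC K x) (h0 : e ≠ 0) : 0 < ⟪f, e⟫ := by
  obtain ⟨s, hs, k, hk, rfl⟩ := he
  rw [inner_smul_right]
  have : s ≠ 0 := by rintro rfl; simp at h0
  have := hf k hk
  positivity

lemma EC_zero {n : ℕ} {K : Set (Euc n)} {x f e : Euc n} (hf : ∀ k ∈ K, 0 < ⟪f, k - x⟫)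
    (he : e ∈ EC K x) (h0 : ⟪f, e⟫ = 0) : e = 0 := by
  by_contra hne
  rcases (EC_iff K x e).1 he with h | h
  · have := DC_pos hf h hne
    linarith
  · have := DC_pos hf h (neg_ne_zero.2 hne)
    rw [inner_neg_right] at this
    linarith

lemma EC_DC {n : ℕ} {K : Set (Euc n)} {x f e : Euc n} (hf : ∀ k ∈ K, 0 < ⟪f, k - x⟫)
    (he : e ∈ EC K x) (h0 : 0 < ⟪f, e⟫) : e ∈ DC K x := by
  rcases (EC_iff K x e).1 he with h | h
  · exact h
  · by_cases hne : e = 0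
    · rw [hne, neg_zero] at h
      rwa [hne]
    · have := DC_pos hf h (neg_ne_zero.2 hne)
      rw [inner_neg_right] at this
      linarith

lemma EC_smul {n : ℕ} {K : Set (Euc n)} {x e : Euc n} (t : ℝ) (he : e ∈ EC K x) :
    t • e ∈ EC K x := by
  obtain ⟨s, k, hk, rfl⟩ := he
  exact ⟨t * s, k, hk, by rw [mul_smul]⟩

lemma DC_smul {n : ℕ} {K : Set (Euc n)} {x e : Euc n} (t : ℝ) (ht : 0 ≤ t) (he : e ∈ DC K x) :
    t • e ∈ DC K x := by
  obtain ⟨s, hs, k, hk, rfl⟩ := he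
  exact ⟨t * s, by positivity, k, hk, by rw [mul_smul]⟩

lemma DC_add {n : ℕ} {K : Set (Euc n)} (hc : Convex ℝ K) {x e e' : Euc n} (he : e ∈ DC K x)
    (he' : e' ∈ DC K x) : e + e' ∈ DC K x := by
  obtain ⟨s, hs, k, hk, rfl⟩ := he
  obtain ⟨s', hs', k', hk', rfl⟩ := he'
  rcases (add_nonneg hs hs').eq_or_lt with h | h
  · have h1 : s = 0 := by linarith
    have h2 : s' = 0 := by linarith
    exact ⟨0, le_rfl, k, hk, by simp [h1, h2]⟩
  · refine ⟨s + s', h.le, (s / (s + s')) • k + (s' / (s + s')) • k',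
      hc hk hk' (by positivity) (by positivity) (by field_simp), ?_⟩
    simp only [smul_sub, smul_add, smul_smul, add_smul]
    have e1 : (s + s') * (s / (s + s')) = s := by field_simp
    have e2 : (s + s') * (s' / (s + s')) = s' := by field_simp
    rw [e1, e2]
    abel

lemma EC_closed {n : ℕ} {K : Set (Euc n)} (hK : IsCompact K) {x f : Euc n}
    (hf : ∀ k ∈ K, 0 < ⟪f, k - x⟫) : IsClosed (EC K x) := by
  rcases K.eq_empty_or_nonempty with rfl | hne
  · have : EC (∅ : Set (Euc n)) x = ∅ := by ext; simp [EC]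
    rw [this]; exact isClosed_empty
  obtain ⟨k0, hk0, hmin⟩ := hK.exists_isMinOn hne
    (f := fun k => ⟪f, k - x⟫) (by fun_prop)
  set δ := ⟪f, k0 - x⟫ with hδ
  have hδ0 : 0 < δ := hf k0 hk0
  refine isClosed_of_closure_subset fun z hz => ?_
  set M := ‖f‖ * (‖z‖ + 1) / δ with hM
  set C : Set (Euc n) := (fun q : ℝ × Euc n => q.1 • (q.2 - x)) '' (Icc (-M) M ×ˢ K) with hC
  have hCc : IsCompact C := (isCompact_Icc.prod hK).image (by fun_prop)
  have hsub : ball z 1 ∩ EC K x ⊆ C := by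
    rintro w ⟨hw, s, k, hk, rfl⟩
    refine ⟨(s, k), ⟨?_, hk⟩, rfl⟩
    have h1 : ‖s • (k - x)‖ ≤ ‖z‖ + 1 := by
      have := norm_sub_norm_le (s • (k - x)) z
      rw [mem_ball, dist_eq_norm] at hw
      linarith
    have h2 : |s| * δ ≤ ‖f‖ * (‖z‖ + 1) := by
      calc |s| * δ ≤ |s| * ⟪f, k - x⟫ := by
            gcongr
            exact hmin hk
        _ = |⟪f, s • (k - x)⟫| := by
            rw [inner_smul_right, abs_mul, abs_of_pos (hf k hk)]
        _ ≤ ‖f‖ * ‖s • (k - x)‖ := abs_real_inner_le_norm _ _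
        _ ≤ _ := by gcongr
    have h3 : |s| ≤ M := by
      rw [hM, le_div_iff₀ hδ0]; exact h2
    exact abs_le.1 h3
  have hz2 : z ∈ closure (ball z 1 ∩ EC K x) :=
    isOpen_ball.inter_closure ⟨mem_ball_self one_pos, hz⟩
  have hz3 : z ∈ C := by
    have := closure_mono hsub hz2
    rwa [hCc.isClosed.closure_eq] at this
  obtain ⟨⟨s, k⟩, ⟨_, hk⟩, rfl⟩ := hz3
  exact ⟨s, k, hk, rfl⟩

lemma EC_rec {n : ℕ} {K : Set (Euc n)} {x m v : Euc n} (hcl : IsClosed (EC K x))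
    (h : ∀ s : ℝ, 0 ≤ s → m + s • v ∈ EC K x) : v ∈ EC K x := by
  have h1 : Filter.Tendsto (fun j : ℕ => ((1 : ℝ) / ((j : ℝ) + 1)) • m + v) Filter.atTop
      (nhds ((0 : ℝ) • m + v)) :=
    (tendsto_one_div_add_atTop_nhds_zero_nat.smul_const m).add_const v
  rw [zero_smul, zero_add] at h1
  refine hcl.mem_of_tendsto h1 (Filter.Eventually.of_forall fun j => ?_)
  have h2 := EC_smul ((1 : ℝ) / ((j : ℝ) + 1)) (h ((j : ℝ) + 1) (by positivity))
  rw [smul_add, smul_smul] at h2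
  have : (1 : ℝ) / ((j : ℝ) + 1) * ((j : ℝ) + 1) = 1 := by field_simp
  rwa [this, one_smul] at h2

lemma front_nonempty {X : Type*} [TopologicalSpace X] {t s : Set X} (ht : IsPreconnected t)
    (h1 : (t ∩ s).Nonempty) (h2 : (t ∩ sᶜ).Nonempty) : (t ∩ frontier s).Nonempty := by
  by_contra hcon
  rw [not_nonempty_iff_eq_empty] at hcon
  have hnf : ∀ z ∈ t, z ∉ frontier s := fun z hz hf => by
    have : z ∈ t ∩ frontier s := ⟨hz, hf⟩
    rw [hcon] at this
    exact this
  have hsub : t ⊆ interior s ∪ (closure s)ᶜ := by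
    intro z hz
    by_cases hzi : z ∈ interior s
    · exact Or.inl hzi
    · exact Or.inr fun hc => hnf z hz ⟨hc, hzi⟩
  obtain ⟨a, hat, has⟩ := h1
  obtain ⟨b, hbt, hbs⟩ := h2
  have hai : a ∈ interior s := by
    rcases hsub hat with h | h
    · exact h
    · exact absurd (subset_closure has) h
  have := IsPreconnected.subset_left_of_subset_union isOpen_interior
    isClosed_closure.isOpen_compl
    (disjoint_left.2 fun z hz hz' => hz' (subset_closure (interior_subset hz))) hsub
    ⟨a, hat, hai⟩ ht
  exact hbs (interior_subset (this hbt))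

lemma EC_exit {n : ℕ} {K : Set (Euc n)} {x m v : Euc n} (hcl : IsClosed (EC K x))
    (hm : m ∈ EC K x) (hv : v ∉ EC K x) :
    ∃ s : ℝ, 0 ≤ s ∧ m + s • v ∈ frontier (EC K x) := by
  have h1 : ∃ s : ℝ, 0 ≤ s ∧ m + s • v ∉ EC K x := by
    by_contra hcon
    push Not at hcon
    exact hv (EC_rec hcl hcon)
  obtain ⟨s1, hs1, h1⟩ := h1
  have hpre : IsPreconnected ((fun s : ℝ => m + s • v) '' Ici 0) :=
    isPreconnected_Ici.image _ (by fun_prop)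
  obtain ⟨z, ⟨s, hs, rfl⟩, hz⟩ := front_nonempty hpre
    (s := EC K x) ⟨m, ⟨0, by simp, by simp⟩, hm⟩ ⟨_, ⟨s1, hs1, rfl⟩, h1⟩
  exact ⟨s, hs, hz⟩

lemma front_smul {n : ℕ} {K : Set (Euc n)} {x e : Euc n} (t : ℝ) (ht : t ≠ 0)
    (he : e ∈ frontier (EC K x)) : t • e ∈ frontier (EC K x) := by
  have h1 : EC K x = (Homeomorph.smulOfNeZero t ht) ⁻¹' (EC K x) := by
    ext e
    simp only [mem_preimage, Homeomorph.smulOfNeZero_apply]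
    refine ⟨EC_smul t, fun h => ?_⟩
    have := EC_smul t⁻¹ h
    rwa [smul_smul, inv_mul_cancel₀ ht, one_smul] at this
  rw [h1, ← Homeomorph.preimage_frontier] at he
  exact he

lemma exists_orth {n : ℕ} (hn : 3 ≤ n) (a b : Euc n) :
    ∃ v : Euc n, v ≠ 0 ∧ ⟪a, v⟫ = 0 ∧ ⟪b, v⟫ = 0 := by
  let T : Euc n →ₗ[ℝ] (Fin 2 → ℝ) :=
    LinearMap.pi ![(innerₛₗ ℝ a), (innerₛₗ ℝ b)]
  have hT : LinearMap.ker T ≠ ⊥ := by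
    apply LinearMap.ker_ne_bot_of_finrank_lt
    simp; omega
  obtain ⟨v, hv, hv0⟩ := Submodule.exists_mem_ne_zero_of_ne_bot hT
  refine ⟨v, hv0, ?_, ?_⟩
  · have := congrFun (LinearMap.mem_ker.1 hv) 0
    simpa [T] using this
  · have := congrFun (LinearMap.mem_ker.1 hv) 1
    simpa [T] using this

lemma int_EC {n : ℕ} {K : Set (Euc n)} {x k : Euc n} (hk : k ∈ interior K) :
    k - x ∈ interior (EC K x) := by
  have h1 : (Homeomorph.addLeft x) ⁻¹' (interior K) ⊆ interior (EC K x) := by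
    apply interior_maximal
    · intro e he
      have he' : x + e ∈ K := interior_subset he
      exact ⟨1, x + e, he', by simp⟩
    · exact isOpen_interior.preimage (Homeomorph.addLeft x).continuous
  apply h1
  simpa using hk

lemma apex {n : ℕ} (hn : 3 ≤ n) {K : Set (Euc n)} (hK : IsCompact K) {k0 : Euc n}
    (hk0 : k0 ∈ interior K) {x y f : Euc n} (hf : ∀ k ∈ K, 0 < ⟪f, k - x⟫)
    {p : Euc n} (hp : supportCone K y = (fun z => p + z) '' supportCone K x) :
    frontier (EC K y) = frontier (EC K x) := by
  obtain ⟨r, hr⟩ : ∃ r, r = y - p - x := ⟨_, rfl⟩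
  have hcl := EC_closed hK hf
  have hAE : frontier (EC K x) ⊆ EC K x := hcl.frontier_subset
  have key : ∀ e, e ∈ frontier (EC K y) ↔ r + e ∈ frontier (EC K x) := by
    intro e
    rw [← mem_front, ← mem_front, hp]
    constructor
    · rintro ⟨z, hz, hze⟩
      have : x + (r + e) = z := by
        simp only at hze
        have h2 : e = p + z - y := by rw [hze]; abel
        rw [hr, h2]; abel
      rwa [this]
    · intro h
      exact ⟨_, h, by simp only [hr]; abel⟩
  suffices h0 : r = 0 by
    ext e; rw [key, h0, zero_add]
  have t1 : ∀ τ : ℝ, τ ≠ 0 → ∀ e ∈ frontier (EC K x), e + (τ - 1) • r ∈ frontier (EC K x) := by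
    intro τ hτ e he
    have h1 : e - r ∈ frontier (EC K y) := by
      rw [key]; simpa using he
    have h2 := (key _).1 (front_smul τ⁻¹ (inv_ne_zero hτ) h1)
    have h3 := front_smul τ hτ h2
    rw [smul_add, smul_smul, mul_inv_cancel₀ hτ, one_smul] at h3
    have : e + (τ - 1) • r = τ • r + (e - r) := by rw [sub_smul, one_smul]; abel
    rwa [this]
  have t2 : ∀ s : ℝ, ∀ e ∈ frontier (EC K x), e + s • r ∈ frontier (EC K x) := by
    intro s e he
    by_cases hs : s + 1 = 0
    · have h1 := t1 2 (by norm_num) e he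
      have h2 := t1 (-1) (by norm_num) _ h1
      have h3 : s = -1 := by linarith
      have : e + s • r = e + (2 - 1 : ℝ) • r + (-1 - 1 : ℝ) • r := by
        rw [h3]; module
      rwa [this]
    · have := t1 (s + 1) hs e he
      simpa using this
  by_contra hr0
  obtain ⟨v, hv0, hfv, -⟩ := exists_orth hn f f
  have hvE : v ∉ EC K x := fun h => hv0 (EC_zero hf h hfv)
  have hvE' : -v ∉ EC K x := fun h => hvE (by simpa using EC_smul (-1) h)
  have he0 : k0 - x ∈ EC K x := interior_subset (int_EC hk0)
  obtain ⟨s1, hs1, hz1⟩ := EC_exit hcl he0 hvE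
  obtain ⟨s2, hs2, hz2⟩ := EC_exit hcl he0 hvE'
  have hfr : ⟪f, r⟫ ≠ 0 := by
    intro h
    exact hr0 (EC_zero hf (EC_rec hcl fun s _ => hAE (t2 s _ hz1)) h)
  have hfz1 : ⟪f, k0 - x + s1 • v⟫ = ⟪f, k0 - x⟫ := by
    rw [inner_add_right, inner_smul_right, hfv]; ring
  have hfz2 : ⟪f, k0 - x + s2 • (-v)⟫ = ⟪f, k0 - x⟫ := by
    rw [inner_add_right, inner_smul_right, inner_neg_right, hfv]; ring
  have e1 := EC_zero hf (hAE (t2 (-⟪f, k0 - x⟫ / ⟪f, r⟫) _ hz1)) (by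
    rw [inner_add_right, hfz1, inner_smul_right]; field_simp; ring)
  have e2 := EC_zero hf (hAE (t2 (-⟪f, k0 - x⟫ / ⟪f, r⟫) _ hz2)) (by
    rw [inner_add_right, hfz2, inner_smul_right]; field_simp; ring)
  have e3 : (s1 + s2) • v = 0 := by
    have := e1.trans e2.symm
    have h4 := add_right_cancel this
    have h5 := add_left_cancel h4
    rw [add_smul, h5]; simp
  rcases smul_eq_zero.1 e3 with h | h
  · have : s1 = 0 := by linarith
    rw [this, zero_smul, add_zero] at hz1
    exact hz1.2 (int_EC hk0)
  · exact hv0 h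

lemma sign_lem {n : ℕ} (hn : 3 ≤ n) {K : Set (Euc n)} (hK : IsCompact K) (hc : Convex ℝ K)
    {x y f f' : Euc n} (hf : ∀ k ∈ K, 0 < ⟪f, k - x⟫) (hf' : ∀ k ∈ K, 0 < ⟪f', k - y⟫)
    (hA : frontier (EC K y) = frontier (EC K x)) {d1 d2 : Euc n} (h1 : d1 ∈ DC K y)
    (h2 : d2 ∈ DC K y) (h10 : d1 ≠ 0) (h20 : d2 ≠ 0) (hx1 : d1 ∈ DC K x) (hx2 : -d2 ∈ DC K x) :
    False := by
  have p1 := DC_pos hf hx1 h10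
  have p2 := DC_pos hf hx2 (neg_ne_zero.2 h20)
  rw [inner_neg_right] at p2
  have q1 := DC_pos hf' h1 h10
  have q2 := DC_pos hf' h2 h20
  obtain ⟨v, hv0, hfv, hfv'⟩ := exists_orth hn f f'
  have hm : (-⟪f, d2⟫) • d1 + ⟪f, d1⟫ • d2 ∈ DC K y :=
    DC_add hc (DC_smul _ p2.le h1) (DC_smul _ p1.le h2)
  have hcl := EC_closed hK hf'
  obtain ⟨s, hs, hz⟩ := EC_exit hcl ((EC_iff K y _).2 (Or.inl hm))
    (fun h => hv0 (EC_zero hf' h hfv') : v ∉ EC K y)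
  rw [hA] at hz
  have hz0 := EC_zero hf ((EC_closed hK hf).frontier_subset hz) (by
    simp only [inner_add_right, inner_smul_right, hfv]; ring)
  have := congrArg (fun z => ⟪f', z⟫) hz0
  simp only [inner_add_right, inner_smul_right, hfv', inner_zero_right] at this
  nlinarith [mul_pos p2 q1, mul_pos p1 q2]

lemma hull_lem {n : ℕ} (hn : 3 ≤ n) {K : Set (Euc n)} (hK : IsCompact K)
    {y f u : Euc n} (hf : ∀ k ∈ K, 0 < ⟪f, k - y⟫)
    (h : ∀ d ∈ DC K y, d ∈ frontier (EC K y) → ⟪u, d⟫ ≤ 0) : ∀ d ∈ DC K y, ⟪u, d⟫ ≤ 0 := by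
  intro d hd
  by_cases hd0 : d = 0
  · simp [hd0]
  have hpos := DC_pos hf hd hd0
  have hcl := EC_closed hK hf
  obtain ⟨v, hv0, hfv, -⟩ := exists_orth hn f f
  have hvE : v ∉ EC K y := fun h => hv0 (EC_zero hf h hfv)
  have hvE' : -v ∉ EC K y := fun h => hvE (by simpa using EC_smul (-1) h)
  have he0 : d ∈ EC K y := (EC_iff K y _).2 (Or.inl hd)
  obtain ⟨s1, hs1, hz1⟩ := EC_exit hcl he0 hvE
  obtain ⟨s2, hs2, hz2⟩ := EC_exit hcl he0 hvE'
  have b1 := h _ (EC_DC hf (hcl.frontier_subset hz1) (by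
    rw [inner_add_right, inner_smul_right, hfv]; linarith)) hz1
  have b2 := h _ (EC_DC hf (hcl.frontier_subset hz2) (by
    rw [inner_add_right, inner_smul_right, inner_neg_right, hfv]; linarith)) hz2
  rw [inner_add_right, inner_smul_right] at b1 b2
  rw [inner_neg_right] at b2
  rcases le_total 0 ⟪u, v⟫ with hh | hh
  · nlinarith
  · nlinarith

lemma touch_lem {n : ℕ} {K : Set (Euc n)}
    {x f u d : Euc n} (hf : ∀ k ∈ K, 0 < ⟪f, k - x⟫) (hu : u ≠ 0)
    (h : ∀ e ∈ DC K x, ⟪u, e⟫ ≤ 0) (hd : d ∈ DC K x) (hd0 : d ≠ 0) (hud : ⟪u, d⟫ = 0) :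
    d ∈ frontier (EC K x) := by
  refine ⟨subset_closure ((EC_iff K x d).2 (Or.inl hd)), fun hint => ?_⟩
  have hpos := DC_pos hf hd hd0
  have hct : Filter.Tendsto (fun ε : ℝ => d + ε • u) (nhdsWithin 0 (Ioi 0)) (nhds d) := by
    have : Continuous (fun ε : ℝ => d + ε • u) := by fun_prop
    have h2 := this.tendsto 0
    simp only [zero_smul, add_zero] at h2
    exact h2.mono_left nhdsWithin_le_nhds
  have ev1 := hct.eventually (isOpen_interior.mem_nhds hint)
  have hop : IsOpen {e : Euc n | 0 < ⟪f, e⟫} := isOpen_lt (by fun_prop) (by fun_prop)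
  have ev2 := hct.eventually (hop.mem_nhds hpos)
  obtain ⟨ε, ⟨h1, h2⟩, h3⟩ := ((ev1.and ev2).and self_mem_nhdsWithin).exists
  have h4 := h _ (EC_DC hf (interior_subset h1) h2)
  rw [inner_add_right, hud, inner_smul_right] at h4
  have h5 : 0 < ⟪u, u⟫ := real_inner_self_pos.2 hu
  have h6 : (0 : ℝ) < ε := h3
  nlinarith [mul_pos h6 h5]

/-- `g` is a contact point of `K` in direction `u`. -/
def Sup {n : ℕ} (K : Set (Euc n)) (u g : Euc n) : Prop := g ∈ K ∧ ∀ k ∈ K, ⟪u, k⟫ ≤ ⟪u, g⟫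

lemma ivt_lem {n : ℕ} {K : Set (Euc n)} (hK : IsCompact K) {x a b : Euc n}
    (ha : ∀ k ∈ K, ⟪a, k - x⟫ < 0) (hb : ∃ k ∈ K, 0 < ⟪b, k - x⟫) :
    ∃ t : ℝ, 0 < t ∧ t < 1 ∧ ∃ g, Sup K ((1 - t) • a + t • b) g ∧
      ⟪(1 - t) • a + t • b, x⟫ = ⟪(1 - t) • a + t • b, g⟫ := by
  obtain ⟨k1, hk1, hb⟩ := hb
  let G : ℝ → Euc n → ℝ := fun t k => ⟪(1 - t) • a + t • b, k - x⟫
  let F : ℝ → ℝ := fun t => sSup (G t '' K)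
  have hFc : Continuous F := by
    apply hK.continuous_sSup (f := G)
    show Continuous (fun p : ℝ × Euc n => ⟪(1 - p.1) • a + p.1 • b, p.2 - x⟫)
    fun_prop
  have hat : ∀ t, ∃ g ∈ K, F t = G t g ∧ ∀ k ∈ K, G t k ≤ G t g := fun t =>
    hK.exists_sSup_image_eq_and_ge ⟨k1, hk1⟩ (by
      have : Continuous (G t) := by
        show Continuous (fun k => ⟪(1 - t) • a + t • b, k - x⟫)
        fun_prop
      exact this.continuousOn)
  have h0 : F 0 < 0 := by
    obtain ⟨g, hg, h1, -⟩ := hat 0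
    rw [h1]; simpa [G] using ha g hg
  have h1 : 0 < F 1 := by
    obtain ⟨g, hg, h1, h2⟩ := hat 1
    rw [h1]
    refine lt_of_lt_of_le ?_ (h2 k1 hk1)
    simpa [G] using hb
  obtain ⟨t, ⟨ht0, ht1⟩, ht⟩ := intermediate_value_Icc (zero_le_one' ℝ) hFc.continuousOn
    ⟨h0.le, h1.le⟩
  have hne0 : t ≠ 0 := by rintro rfl; linarith
  have hne1 : t ≠ 1 := by rintro rfl; linarith
  obtain ⟨g, hg, h3, h4⟩ := hat t
  refine ⟨t, lt_of_le_of_ne ht0 hne0.symm, lt_of_le_of_ne ht1 hne1, g, ⟨hg, fun k hk => ?_⟩, ?_⟩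
  · have := h4 k hk
    simp only [G, inner_sub_right] at this
    linarith
  · have : G t g = 0 := by rw [← h3, ht]
    simp only [G, inner_sub_right] at this
    linarith

lemma span_lem {n : ℕ} (hn : 3 ≤ n) {K : Set (Euc n)} (hK : IsCompact K) {k0 : Euc n}
    (hk0 : k0 ∈ interior K) {x f w : Euc n} (hf : ∀ k ∈ K, 0 < ⟪f, k - x⟫)
    (h : ∀ u g, u ≠ 0 → Sup K u g → ⟪u, x⟫ = ⟪u, g⟫ → ⟪u, w⟫ = 0) : w = 0 := by
  have hk0K : k0 ∈ K := interior_subset hk0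
  obtain ⟨v, hv0, hkv, -⟩ := exists_orth hn (k0 - x) (k0 - x)
  rw [real_inner_comm] at hkv
  have hvv : 0 < ⟪v, v⟫ := real_inner_self_pos.2 hv0
  have hct : Filter.Tendsto (fun ε : ℝ => k0 + ε • v) (nhds 0) (nhds k0) := by
    have : Continuous (fun ε : ℝ => k0 + ε • v) := by fun_prop
    have h2 := this.tendsto 0
    simpa only [zero_smul, add_zero] using h2
  have ev := hct.eventually (mem_interior_iff_mem_nhds.1 hk0)
  obtain ⟨ε, hε, hball⟩ := Metric.eventually_nhds_iff.1 ev
  have hp : k0 + (ε / 2) • v ∈ K := hball (by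
    rw [dist_zero_right, Real.norm_eq_abs, abs_of_pos (by positivity)]; linarith)
  have hm : k0 + (-(ε / 2)) • v ∈ K := hball (by
    rw [dist_zero_right, Real.norm_eq_abs, abs_neg, abs_of_pos (by positivity)]; linarith)
  have hpv : ∃ k ∈ K, 0 < ⟪v, k - x⟫ := ⟨_, hp, by
    rw [add_sub_right_comm, inner_add_right, hkv, inner_smul_right]; positivity⟩
  have hmv : ∃ k ∈ K, 0 < ⟪-v, k - x⟫ := ⟨_, hm, by
    rw [add_sub_right_comm, inner_add_right, inner_neg_left, hkv, inner_smul_right, inner_neg_left]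
    have : 0 < ε / 2 * ⟪v, v⟫ := by positivity
    linarith⟩
  have step : ∀ a : Euc n, (∀ k ∈ K, ⟪a, k - x⟫ < 0) → ⟪a, w⟫ = 0 := by
    intro a ha
    obtain ⟨t, ht0, ht1, g, hg, hxg⟩ := ivt_lem hK ha hpv
    obtain ⟨t', ht0', ht1', g', hg', hxg'⟩ := ivt_lem hK ha hmv
    have hak := ha k0 hk0K
    have n1 : (1 - t) • a + t • v ≠ 0 := by
      intro h0
      have := congrArg (fun z => ⟪z, k0 - x⟫) h0
      simp only [inner_add_left, real_inner_smul_left, hkv, inner_zero_left] at this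
      nlinarith
    have n2 : (1 - t') • a + t' • (-v) ≠ 0 := by
      intro h0
      have := congrArg (fun z => ⟪z, k0 - x⟫) h0
      simp only [inner_add_left, real_inner_smul_left, inner_neg_left, hkv, inner_zero_left] at this
      nlinarith
    have e1 := h _ g n1 hg hxg
    have e2 := h _ g' n2 hg' hxg'
    simp only [inner_add_left, real_inner_smul_left, inner_neg_left] at e1 e2
    have e3 : (t' * (1 - t) + t * (1 - t')) * ⟪a, w⟫ = 0 := by
      linear_combination t' * e1 + t * e2
    rcases mul_eq_zero.1 e3 with h4 | h4
    · nlinarith [mul_pos ht0' (sub_pos.2 ht1), mul_pos ht0 (sub_pos.2 ht1')]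
    · exact h4
  obtain ⟨k1, hk1, hmin⟩ := hK.exists_isMinOn ⟨k0, hk0K⟩
    (f := fun k => ⟪f, k - x⟫) (by fun_prop)
  obtain ⟨k2, hk2, hmax⟩ := hK.exists_isMaxOn ⟨k0, hk0K⟩
    (f := fun k => |⟪w, k - x⟫|) (by fun_prop)
  have hδ := hf k1 hk1
  set δ := ⟪f, k1 - x⟫
  set M := |⟪w, k2 - x⟫|
  have hM : 0 ≤ M := abs_nonneg _
  have f1 := step (-f) (fun k hk => by rw [inner_neg_left]; linarith [hf k hk])
  have f2 := step (-f + (δ / (M + 1)) • w) (fun k hk => by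
    have a1 : δ ≤ ⟪f, k - x⟫ := hmin hk
    have a2 : |⟪w, k - x⟫| ≤ M := hmax hk
    rw [inner_add_left, inner_neg_left, real_inner_smul_left]
    have a3 : δ / (M + 1) * ⟪w, k - x⟫ ≤ δ / (M + 1) * M := by
      gcongr
      exact (le_abs_self _).trans a2
    have a4 : δ / (M + 1) * M < δ := by
      rw [div_mul_eq_mul_div, div_lt_iff₀ (by positivity)]
      nlinarith
    linarith)
  rw [inner_add_left, f1, real_inner_smul_left, zero_add] at f2
  have : δ / (M + 1) ≠ 0 := by positivity
  exact inner_self_eq_zero.1 ((mul_eq_zero.1 f2).resolve_left this)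

lemma main_AB {n : ℕ} (hn : 3 ≤ n) {K : Set (Euc n)} (hK : IsConvexBody K) {x y : Euc n}
    (hx : x ∉ K) (hy : y ∉ K) (hxy : y ≠ x) {p : Euc n}
    (hp : supportCone K y = (fun z => p + z) '' supportCone K x) {u g : Euc n} (hu : u ≠ 0)
    (hg : Sup K u g) (hxg : ⟪u, x⟫ = ⟪u, g⟫) :
    ∃ g', ∃ l : ℝ, 0 < l ∧ Sup K (-u) g' ∧ y - g' = (-l) • (x - g) := by
  obtain ⟨hKc, hc, k0, hk0⟩ := hK
  obtain ⟨f, hf⟩ := exists_f K hKc hc x hx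
  obtain ⟨f', hf'⟩ := exists_f K hKc hc y hy
  have hA := apex hn hKc hk0 hf hp
  have hclx := EC_closed hKc hf
  have hcly := EC_closed hKc hf'
  -- facts on contact
  have hneg : ∀ u g : Euc n, Sup K u g → ⟪u, x⟫ = ⟪u, g⟫ → ∀ e ∈ DC K x, ⟪u, e⟫ ≤ 0 := by
    rintro u g hg hxg e ⟨s, hs, k, hk, rfl⟩
    rw [inner_smul_right, inner_sub_right]
    have := hg.2 k hk
    nlinarith
  have hgx : ∀ g ∈ K, g - x ≠ 0 := fun g hg h => hx (by rwa [← sub_eq_zero.1 h])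
  have hgD : ∀ g ∈ K, g - x ∈ DC K x := fun g hg => ⟨1, zero_le_one, g, hg, by simp⟩
  have hfr : ∀ u g : Euc n, u ≠ 0 → Sup K u g → ⟪u, x⟫ = ⟪u, g⟫ → g - x ∈ frontier (EC K x) :=
    fun u g hu hg hxg => touch_lem hf hu (hneg u g hg hxg) (hgD g hg.1) (hgx g hg.1)
      (by rw [inner_sub_right]; linarith)
  have minus : ∀ d ∈ DC K y, d ∈ frontier (EC K y) → -d ∈ DC K x := by
    by_contra hcon
    push Not at hcon
    obtain ⟨d0, hd0, hd0A, hd0x⟩ := hcon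
    have h0D : (0 : Euc n) ∈ DC K x := ⟨0, le_rfl, k0, interior_subset hk0, by simp⟩
    have hd00 : d0 ≠ 0 := by
      rintro rfl
      exact hd0x (by simpa using h0D)
    have hd0x' : d0 ∈ DC K x :=
      ((EC_iff K x d0).1 (hclx.frontier_subset (hA ▸ hd0A))).resolve_right hd0x
    have plus : ∀ d ∈ DC K y, d ∈ frontier (EC K y) → d ∈ DC K x := by
      intro d hd hdA
      by_cases h0 : d = 0
      · rw [h0]; exact h0D
      rcases (EC_iff K x d).1 (hclx.frontier_subset (hA ▸ hdA)) with h | h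
      · exact h
      · exact (sign_lem hn hKc hc hf hf' hA hd0 hd hd00 h0 hd0x' h).elim
    apply hxy
    rw [← sub_eq_zero]
    apply span_lem hn hKc hk0 hf
    intro u g hu hg hxg
    have hy1 : ∀ d ∈ DC K y, ⟪u, d⟫ ≤ 0 :=
      hull_lem hn hKc hf' fun d hd hdA => hneg u g hg hxg d (plus d hd hdA)
    have h2 : g - x ∈ EC K y := hcly.frontier_subset (hA ▸ hfr u g hu hg hxg)
    obtain ⟨s, k, hk, hs⟩ := h2
    have hs0 : s ≠ 0 := by
      rintro rfl
      exact hgx g hg.1 (by simpa using hs)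
    have h3 := congrArg (fun z => ⟪u, z⟫) hs
    simp only [inner_smul_right, inner_sub_right] at h3
    have h4 : ⟪u, k⟫ - ⟪u, y⟫ = 0 := by
      have : s * (⟪u, k⟫ - ⟪u, y⟫) = 0 := by linarith
      exact (mul_eq_zero.1 this).resolve_left hs0
    have h5 := hy1 (g - y) ⟨1, zero_le_one, g, hg.1, by simp⟩
    have h6 := hg.2 k hk
    rw [inner_sub_right] at h5 ⊢
    linarith
  have hd := hfr u g hu hg hxg
  have hyu : ∀ d ∈ DC K y, ⟪-u, d⟫ ≤ 0 :=
    hull_lem hn hKc hf' fun d hd hdA => by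
      have := hneg u g hg hxg _ (minus d hd hdA)
      rw [inner_neg_left]; rwa [inner_neg_right] at this
  have hdy : -(g - x) ∈ DC K y := by
    rcases (EC_iff K y _).1 (hcly.frontier_subset (hA ▸ hd)) with h | h
    · exfalso
      have h1 := minus _ h (hA ▸ hd)
      have p1 := DC_pos hf h1 (neg_ne_zero.2 (hgx g hg.1))
      have p2 := DC_pos hf (hgD g hg.1) (hgx g hg.1)
      rw [inner_neg_right] at p1
      linarith
    · exact h
  obtain ⟨s, hs, k, hk, hsk⟩ := hdy
  have hs0 : s ≠ 0 := by
    rintro rfl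
    exact hgx g hg.1 (neg_eq_zero.1 (by rw [hsk, zero_smul]))
  have hspos : 0 < s := lt_of_le_of_ne hs hs0.symm
  refine ⟨k, s⁻¹, by positivity, ⟨hk, fun k' hk' => ?_⟩, ?_⟩
  · have h1 := hyu (k' - y) ⟨1, zero_le_one, k', hk', by simp⟩
    have h3 := congrArg (fun z => ⟪u, z⟫) hsk
    simp only [inner_smul_right, inner_sub_right, inner_neg_right] at h3
    have h4 : ⟪u, k⟫ - ⟪u, y⟫ = 0 := by
      have : s * (⟪u, k⟫ - ⟪u, y⟫) = 0 := by linarith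
      exact (mul_eq_zero.1 this).resolve_left hs0
    simp only [inner_neg_left, inner_sub_right] at h1 ⊢
    linarith
  · have : x - g = s • (k - y) := by rw [← hsk]; abel
    rw [this, smul_smul, neg_mul, inv_mul_cancel₀ hs0, neg_smul, one_smul]; abel

lemma sup_not_int {n : ℕ} {K : Set (Euc n)} {u g : Euc n} (hu : u ≠ 0) (hg : Sup K u g) :
    g ∉ interior K := by
  intro hint
  have hct : Filter.Tendsto (fun ε : ℝ => g + ε • u) (nhdsWithin 0 (Ioi 0)) (nhds g) := by
    have : Continuous (fun ε : ℝ => g + ε • u) := by fun_prop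
    have h2 := this.tendsto 0
    simp only [zero_smul, add_zero] at h2
    exact h2.mono_left nhdsWithin_le_nhds
  have ev1 := hct.eventually (mem_interior_iff_mem_nhds.1 hint)
  obtain ⟨ε, h1, h3⟩ := (ev1.and self_mem_nhdsWithin).exists
  have h4 := hg.2 _ h1
  rw [inner_add_right, inner_smul_right] at h4
  have h5 : 0 < ⟪u, u⟫ := real_inner_self_pos.2 hu
  have h6 : (0 : ℝ) < ε := h3
  nlinarith [mul_pos h6 h5]

lemma sup_unique {n : ℕ} {K : Set (Euc n)} (hs : StrictConvex ℝ K) {u g g' : Euc n} (hu : u ≠ 0)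
    (hg : Sup K u g) (hg' : Sup K u g') : g = g' := by
  by_contra hne
  have h1 := hs hg.1 hg'.1 hne (a := 1 / 2) (b := 1 / 2) (by norm_num) (by norm_num) (by norm_num)
  refine sup_not_int hu ⟨interior_subset h1, fun k hk => ?_⟩ h1
  have h2 := hg.2 k hk
  have h3 := hg'.2 k hk
  rw [inner_add_right, inner_smul_right, inner_smul_right]
  linarith

lemma sup_exists {n : ℕ} {K : Set (Euc n)} (hK : IsConvexBody K) (u : Euc n) : ∃ g, Sup K u g := by
  obtain ⟨hKc, hc, k0, hk0⟩ := hK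
  obtain ⟨g, hg, hmax⟩ := hKc.exists_isMaxOn ⟨k0, interior_subset hk0⟩
    (f := fun k => ⟪u, k⟫) (by fun_prop)
  exact ⟨g, hg, fun k hk => hmax hk⟩

def CRel {n : ℕ} (K L : Set (Euc n)) (x y : Euc n) : Prop :=
  x ∈ L ∧ y ∈ L ∧ y ≠ x ∧ ∃ p : Euc n, supportCone K y = (fun z => p + z) '' supportCone K x

lemma CRel.symm {n : ℕ} {K L : Set (Euc n)} {x y : Euc n} (h : CRel K L x y) : CRel K L y x := by
  obtain ⟨h1, h2, h3, p, hp⟩ := h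
  refine ⟨h2, h1, h3.symm, -p, ?_⟩
  rw [hp, image_image]
  simp

structure Ctx {n : ℕ} (K L U : Set (Euc n)) : Prop where
  hn : 3 ≤ n
  body : IsConvexBody K
  strict : StrictConvex ℝ K
  opn : IsOpen U
  sub : K ⊆ U
  disj : ∀ x ∈ U, x ∉ L
  ray : ∀ q ∈ U, ∀ v : Euc n, v ≠ 0 → ∃ s : ℝ, 0 < s ∧ q + s • v ∈ L
  partner : ∀ x ∈ L, ∃ y, CRel K L x y

lemma Ctx.AB {n : ℕ} {K L U : Set (Euc n)} (C : Ctx K L U) {x y u g g' : Euc n}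
    (h : CRel K L x y) (hu : u ≠ 0) (hg : Sup K u g) (hg' : Sup K (-u) g')
    (hxg : ⟪u, x⟫ = ⟪u, g⟫) : ∃ l : ℝ, 0 < l ∧ y - g' = (-l) • (x - g) := by
  obtain ⟨h1, h2, h3, p, hp⟩ := h
  obtain ⟨g'', l, hl, hg'', he⟩ := main_AB C.hn C.body (fun h => C.disj x (C.sub h) h1)
    (fun h => C.disj y (C.sub h) h2) h3 hp hu hg hxg
  rw [sup_unique C.strict (neg_ne_zero.2 hu) hg' hg'']
  exact ⟨l, hl, he⟩

lemma Ctx.AB' {n : ℕ} {K L U : Set (Euc n)} (C : Ctx K L U) {x y u g g' : Euc n}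
    (h : CRel K L x y) (hu : u ≠ 0) (hg : Sup K u g) (hg' : Sup K (-u) g')
    (hxg : ⟪u, x⟫ = ⟪u, g⟫) : ⟪u, y⟫ = ⟪u, g'⟫ := by
  obtain ⟨l, hl, he⟩ := C.AB h hu hg hg' hxg
  have := congrArg (fun z => ⟪u, z⟫) he
  simp only [inner_smul_right, inner_sub_right] at this
  rw [hxg, sub_self, mul_zero] at this
  linarith

/-- the parallel lemma -/
lemma Ctx.par {n : ℕ} {K L U : Set (Euc n)} (C : Ctx K L U) {x y x' y' u g w : Euc n}
    (h : CRel K L x y) (h' : CRel K L x' y') (hu : u ≠ 0) (hg : Sup K u g)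
    (hx : ⟪u, x⟫ = ⟪u, g⟫) (hx' : ⟪u, x'⟫ = ⟪u, g⟫) (hw : ⟪w, x⟫ = ⟪w, x'⟫)
    (hwg : ⟪w, g - x⟫ < 0) : ⟪w, y⟫ = ⟪w, y'⟫ := by
  obtain ⟨hKc, hc, k0, hk0⟩ := C.body
  -- strict negativity for large t
  have hT : ∃ T : ℕ, ∀ k ∈ K, ⟪w + (T : ℝ) • u, k - x⟫ < 0 := by
    have hcov := hKc.elim_directed_cover
      (fun T : ℕ => {k : Euc n | ⟪w, k - x⟫ + (T : ℝ) * (⟪u, k⟫ - ⟪u, g⟫) < 0}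
        ∪ {k : Euc n | ⟪u, g⟫ < ⟪u, k⟫})
      (fun T => (isOpen_lt (by fun_prop) (by fun_prop)).union
        (isOpen_lt (by fun_prop) (by fun_prop))) (by
        intro k hk
        rw [mem_iUnion]
        rcases (hg.2 k hk).lt_or_eq with hlt | heq
        · obtain ⟨T, hT⟩ := exists_nat_gt (⟪w, k - x⟫ / (⟪u, g⟫ - ⟪u, k⟫))
          rw [div_lt_iff₀ (by linarith)] at hT
          refine ⟨T, Or.inl ?_⟩
          simp only [mem_ofPred_eq]
          linarith
        · have hkg : k = g := sup_unique C.strict hu ⟨hk, fun k' hk' => by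
            rw [heq]; exact hg.2 k' hk'⟩ hg
          refine ⟨0, Or.inl ?_⟩
          simpa [hkg] using hwg) (by
        apply Monotone.directed_le
        intro T T' hTT k hk
        rcases hk with hk | hk
        · by_cases hgk : ⟪u, g⟫ < ⟪u, k⟫
          · exact Or.inr hgk
          · left
            simp only [mem_ofPred_eq] at hk ⊢
            have : (T : ℝ) ≤ T' := by exact_mod_cast hTT
            nlinarith
        · exact Or.inr hk)
    obtain ⟨T, hT⟩ := hcov
    refine ⟨T, fun k hk => ?_⟩
    rw [inner_add_left, real_inner_smul_left, inner_sub_right u, hx]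
    rcases hT hk with h | h
    · exact h
    · exact absurd (hg.2 k hk) (not_le.2 h)
  obtain ⟨T, hT⟩ := hT
  have hk0u : ⟪u, k0⟫ < ⟪u, g⟫ := by
    refine lt_of_le_of_ne (hg.2 k0 (interior_subset hk0)) fun heq => ?_
    exact sup_not_int hu ⟨interior_subset hk0, fun k hk => by rw [heq]; exact hg.2 k hk⟩ hk0
  obtain ⟨T', hT'⟩ := exists_nat_gt (-⟪w, k0 - x⟫ / (⟪u, g⟫ - ⟪u, k0⟫))
  rw [div_lt_iff₀ (by linarith)] at hT'
  obtain ⟨t, ht0, ht1, g1, hg1, hxg1⟩ := ivt_lem hKc (x := x) (b := w + (-(T' : ℝ)) • u) hT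
    ⟨k0, interior_subset hk0, by
      rw [inner_add_left, real_inner_smul_left, inner_sub_right u, hx]; linarith⟩
  obtain ⟨c, hcdef⟩ : ∃ c : ℝ, c = (1 - t) * T - t * T' := ⟨_, rfl⟩
  have hv : (1 - t) • (w + (T : ℝ) • u) + t • (w + (-(T' : ℝ)) • u) = w + c • u := by
    rw [hcdef]; module
  rw [hv] at hg1 hxg1
  have hv0 : w + c • u ≠ 0 := by
    intro h0
    have := congrArg (fun z => ⟪z, g - x⟫) h0
    simp only [inner_add_left, real_inner_smul_left, inner_zero_left] at this
    rw [inner_sub_right u, hx, sub_self, mul_zero] at this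
    linarith
  obtain ⟨g1', hg1'⟩ := sup_exists C.body (-(w + c • u))
  obtain ⟨g', hg'⟩ := sup_exists C.body (-u)
  have a1 := C.AB' h hv0 hg1 hg1' hxg1
  have a2 := C.AB' h' hv0 hg1 hg1' (by
    rw [← hxg1]
    simp only [inner_add_left, real_inner_smul_left]
    rw [hw, hx, hx'])
  have b1 := C.AB' h hu hg hg' hx
  have b2 := C.AB' h' hu hg hg' hx'
  have a3 := a1.trans a2.symm
  simp only [inner_add_left, real_inner_smul_left] at a3
  rw [b1, b2] at a3
  linarith

lemma exists_w {n : ℕ} {a b : Euc n} (h : LinearIndependent ℝ ![a, b]) :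
    ∃ w : Euc n, ⟪w, a⟫ = ⟪w, b⟫ ∧ ⟪w, a⟫ > 0 := by
  rw [LinearIndependent.pair_iff] at h
  obtain ⟨τ, hτ⟩ : ∃ τ : ℝ, τ = ⟪a, a - b⟫ / ⟪a - b, a - b⟫ := ⟨_, rfl⟩
  have hc : a - b ≠ 0 := by
    intro h0
    have := h 1 (-1) (by simpa [sub_eq_add_neg] using h0)
    norm_num at this
  have hcc : ⟪a - b, a - b⟫ ≠ 0 := (real_inner_self_pos.2 hc).ne'
  obtain ⟨w, hw⟩ : ∃ w : Euc n, w = a - τ • (a - b) := ⟨_, rfl⟩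
  have hw0 : w ≠ 0 := by
    intro h0
    have := h (1 - τ) τ (by rw [← h0, hw]; module)
    linarith [this.1, this.2]
  have h1 : ⟪w, a - b⟫ = 0 := by
    rw [hw, inner_sub_left a, real_inner_smul_left, hτ]; field_simp; ring
  have h2 : ⟪w, w⟫ = ⟪w, a⟫ := by
    nth_rw 2 [hw]
    rw [inner_sub_right w a, inner_smul_right, h1]; ring
  refine ⟨w, ?_, ?_⟩
  · rw [inner_sub_right] at h1; linarith
  · rw [← h2]; exact real_inner_self_pos.2 hw0

lemma Ctx.ratio {n : ℕ} {K L U : Set (Euc n)} (C : Ctx K L U) {x y x' y' u g g' : Euc n}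
    (h : CRel K L x y) (h' : CRel K L x' y') (hu : u ≠ 0) (hg : Sup K u g)
    (hx : ⟪u, x⟫ = ⟪u, g⟫) (hx' : ⟪u, x'⟫ = ⟪u, g⟫) {l l' : ℝ}
    (hl : y - g' = (-l) • (x - g)) (hl' : y' - g' = (-l') • (x' - g))
    (hi : LinearIndependent ℝ ![x - g, x' - g]) : l = l' := by
  obtain ⟨w, hw1, hw2⟩ := exists_w hi
  have h1 := C.par h h' hu hg hx hx' (w := w)
    (by simp only [inner_sub_right] at hw1; linarith)
    (by simp only [inner_sub_right] at hw2 ⊢; linarith)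
  have e1 := congrArg (fun z => ⟪w, z⟫) hl
  have e2 := congrArg (fun z => ⟪w, z⟫) hl'
  simp only [inner_smul_right] at e1 e2
  rw [inner_sub_right] at e1 e2
  rw [← hw1] at e2
  have : (l - l') * ⟪w, x - g⟫ = 0 := by linarith
  rcases mul_eq_zero.1 this with h | h
  · linarith
  · linarith

def Good {n : ℕ} (K L : Set (Euc n)) (u : Euc n) (l : ℝ) : Prop :=
  ∀ g g' x y, Sup K u g → Sup K (-u) g' → CRel K L x y → ⟪u, x⟫ = ⟪u, g⟫ →
    y - g' = (-l) • (x - g)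

lemma Ctx.good {n : ℕ} {K L U : Set (Euc n)} (C : Ctx K L U) {u : Euc n} (hu : u ≠ 0) :
    ∃ l : ℝ, 0 < l ∧ Good K L u l := by
  obtain ⟨g, hg⟩ := sup_exists C.body u
  obtain ⟨g', hg'⟩ := sup_exists C.body (-u)
  obtain ⟨v0, hv0, huv0, -⟩ := exists_orth C.hn u u
  obtain ⟨v1, hv1, huv1, hvv⟩ := exists_orth C.hn u v0
  obtain ⟨s0, hs0, hx0⟩ := C.ray g (C.sub hg.1) v0 hv0
  obtain ⟨s1, hs1, hx1⟩ := C.ray g (C.sub hg.1) v1 hv1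
  obtain ⟨y0, hy0⟩ := C.partner _ hx0
  obtain ⟨y1, hy1⟩ := C.partner _ hx1
  have i0 : ⟪u, g + s0 • v0⟫ = ⟪u, g⟫ := by rw [inner_add_right, inner_smul_right, huv0]; ring
  have i1 : ⟪u, g + s1 • v1⟫ = ⟪u, g⟫ := by rw [inner_add_right, inner_smul_right, huv1]; ring
  obtain ⟨l0, hl0, e0⟩ := C.AB hy0 hu hg hg' i0
  obtain ⟨l1, hl1, e1⟩ := C.AB hy1 hu hg hg' i1
  have ha : s0 • v0 ≠ 0 := smul_ne_zero hs0.ne' hv0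
  have hb : s1 • v1 ≠ 0 := smul_ne_zero hs1.ne' hv1
  have hab : ⟪s0 • v0, s1 • v1⟫ = 0 := by
    rw [real_inner_smul_left, inner_smul_right, hvv]; ring
  have hl01 : l0 = l1 := by
    refine C.ratio hy0 hy1 hu hg i0 i1 e0 e1 ?_
    rw [add_sub_cancel_left, add_sub_cancel_left, LinearIndependent.pair_iff' ha]
    intro c hc
    rw [← hc, inner_smul_right] at hab
    rcases mul_eq_zero.1 hab with h | h
    · rw [h, zero_smul] at hc; exact hb hc.symm
    · exact ha (inner_self_eq_zero.1 h)
  refine ⟨l0, hl0, ?_⟩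
  intro g2 g2' x y hg2 hg2' hr hxg
  obtain rfl := sup_unique C.strict hu hg hg2
  obtain rfl := sup_unique C.strict (neg_ne_zero.2 hu) hg' hg2'
  obtain ⟨l, hl, e⟩ := C.AB hr hu hg hg' hxg
  suffices l0 = l by rw [this]; exact e
  by_cases d0 : LinearIndependent ℝ ![g + s0 • v0 - g, x - g]
  · exact C.ratio hy0 hr hu hg i0 hxg e0 e d0
  by_cases d1 : LinearIndependent ℝ ![g + s1 • v1 - g, x - g]
  · rw [hl01]; exact C.ratio hy1 hr hu hg i1 hxg e1 e d1
  exfalso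
  rw [add_sub_cancel_left, LinearIndependent.pair_iff' ha] at d0
  rw [add_sub_cancel_left, LinearIndependent.pair_iff' hb] at d1
  push Not at d0 d1
  obtain ⟨c0, hc0⟩ := d0
  obtain ⟨c1, hc1⟩ := d1
  have hz : ⟪x - g, x - g⟫ = 0 := by
    nth_rw 1 [← hc0]
    rw [← hc1, real_inner_smul_left, inner_smul_right, hab]; ring
  have : x = g := sub_eq_zero.1 (inner_self_eq_zero.1 hz)
  exact C.disj g (C.sub hg.1) (this ▸ hr.1)

lemma Ctx.cont {n : ℕ} {K L U : Set (Euc n)} (C : Ctx K L U) {u g : Euc n} (hu : u ≠ 0)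
    (hg : Sup K u g) {ε : ℝ} (hε : 0 < ε) :
    ∃ η : ℝ, 0 < η ∧ ∀ u' g', ‖u' - u‖ < η → Sup K u' g' → ‖g' - g‖ < ε := by
  obtain ⟨hKc, hc, k0, hk0⟩ := C.body
  have hcp : IsCompact (K \ ball g ε) := hKc.diff isOpen_ball
  rcases (K \ ball g ε).eq_empty_or_nonempty with he | hne
  · refine ⟨1, one_pos, fun u' g' _ hg' => ?_⟩
    by_contra hcon
    have : g' ∈ K \ ball g ε := ⟨hg'.1, by rwa [mem_ball, dist_eq_norm]⟩
    rw [he] at this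
    exact this
  · obtain ⟨k1, hk1, hmin⟩ := hcp.exists_isMinOn hne
      (f := fun k => ⟪u, g - k⟫) (by fun_prop)
    obtain ⟨k2, hk2, hmax⟩ := hKc.exists_isMaxOn ⟨g, hg.1⟩
      (f := fun k => ‖k - g‖) (by fun_prop)
    have hm : 0 < ⟪u, g - k1⟫ := by
      rw [inner_sub_right, sub_pos]
      refine lt_of_le_of_ne (hg.2 k1 hk1.1) fun heq => ?_
      have : k1 = g := sup_unique C.strict hu ⟨hk1.1, fun k hk => by
        rw [heq]; exact hg.2 k hk⟩ hg
      exact hk1.2 (this ▸ mem_ball_self hε)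
    set m := ⟪u, g - k1⟫
    set M := ‖k2 - g‖
    have hM : 0 ≤ M := norm_nonneg _
    refine ⟨m / (M + 1), by positivity, fun u' g' hu' hg' => ?_⟩
    by_contra hcon
    have h1 : g' ∈ K \ ball g ε := ⟨hg'.1, by rwa [mem_ball, dist_eq_norm]⟩
    have h2 : m ≤ ⟪u, g - g'⟫ := hmin h1
    have h3 : ‖g' - g‖ ≤ M := hmax hg'.1
    have h4 := hg'.2 g hg.1
    have h5 : ⟪u' - u, g' - g⟫ ≤ ‖u' - u‖ * ‖g' - g‖ := real_inner_le_norm _ _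
    have h6 : ‖u' - u‖ * ‖g' - g‖ ≤ m / (M + 1) * M := by gcongr
    have h7 : m / (M + 1) * M < m := by
      rw [div_mul_eq_mul_div, div_lt_iff₀ (by positivity)]
      nlinarith
    simp only [inner_sub_left, inner_sub_right] at h2 h5
    linarith

lemma Ctx.loc {n : ℕ} {K L U : Set (Euc n)} (C : Ctx K L U) {u : Euc n} (hu : ‖u‖ = 1) :
    ∃ η : ℝ, 0 < η ∧ ∀ u', ‖u'‖ = 1 → ‖u' - u‖ < η → ∀ l l', Good K L u l → Good K L u' l' →
      l' = l := by
  have hu0 : u ≠ 0 := by rintro rfl; simp at hu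
  obtain ⟨g, hg⟩ := sup_exists C.body u
  obtain ⟨g1, hg1⟩ := sup_exists C.body (-u)
  obtain ⟨δ, hδ, hball⟩ := Metric.isOpen_iff.1 C.opn g (C.sub hg.1)
  obtain ⟨η, hη, hcont⟩ := C.cont hu0 hg hδ
  refine ⟨min η 1, by positivity, fun u' hu' hd l l' hl hl' => ?_⟩
  have hu0' : u' ≠ 0 := by rintro rfl; simp at hu'
  obtain ⟨g', hg'⟩ := sup_exists C.body u'
  obtain ⟨g1', hg1'⟩ := sup_exists C.body (-u')
  have hgg := hcont u' g' (hd.trans_le (min_le_left _ _)) hg'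
  have huu : ⟪u, u⟫ = 1 := by rw [real_inner_self_eq_norm_sq, hu]; norm_num
  have huu' : ⟪u', u'⟫ = 1 := by rw [real_inner_self_eq_norm_sq, hu']; norm_num
  -- common point
  have hq : ∃ q ∈ U, ⟪u, q⟫ = ⟪u, g⟫ ∧ ⟪u', q⟫ = ⟪u', g'⟫ := by
    have hα : 0 < ⟪u, u'⟫ := by
      have h1 : ‖u' - u‖ ^ 2 < 1 := by
        have : ‖u' - u‖ < 1 := hd.trans_le (min_le_right _ _)
        nlinarith [norm_nonneg (u' - u)]
      rw [← real_inner_self_eq_norm_sq] at h1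
      simp only [inner_sub_left, inner_sub_right, huu, huu', real_inner_comm u u'] at h1
      rw [real_inner_comm] at h1
      linarith [real_inner_comm u u']
    obtain ⟨α, hαd⟩ : ∃ α, α = ⟪u, u'⟫ := ⟨_, rfl⟩
    rw [← hαd] at hα
    obtain ⟨v, hv⟩ : ∃ v, v = u' - α • u := ⟨_, rfl⟩
    have hu'v : u' = α • u + v := by rw [hv]; abel
    have huv : ⟪u, v⟫ = 0 := by
      rw [hv, inner_sub_right, inner_smul_right, huu, ← hαd]; ring
    by_cases hv0 : v = 0
    · have h1 : u' = α • u := by rw [hu'v, hv0, add_zero]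
      have h2 : α = 1 := by
        rw [h1, norm_smul, hu, Real.norm_eq_abs, abs_of_pos hα] at hu'
        linarith
      rw [h2, one_smul] at h1
      subst h1
      exact ⟨g, C.sub hg.1, rfl, by rw [sup_unique C.strict hu0 hg hg']⟩
    · have hvn : 0 < ‖v‖ := norm_pos_iff.2 hv0
      have hvv : ⟪v, v⟫ = ‖v‖ ^ 2 := real_inner_self_eq_norm_sq v
      have hu'v' : ⟪u', v⟫ = ‖v‖ ^ 2 := by
        rw [hu'v, inner_add_left, real_inner_smul_left, huv, hvv]; ring
      obtain ⟨s, hs⟩ : ∃ s, s = ⟪u', g' - g⟫ / ‖v‖ ^ 2 := ⟨_, rfl⟩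
      have hs0 : 0 ≤ ⟪u', g' - g⟫ := by
        rw [inner_sub_right]; linarith [hg'.2 g hg.1]
      have hs1 : ⟪u', g' - g⟫ ≤ ‖v‖ * ‖g' - g‖ := by
        have h1 : ⟪u', g' - g⟫ = α * ⟪u, g' - g⟫ + ⟪v, g' - g⟫ := by
          conv_lhs => rw [hu'v]
          rw [inner_add_left, real_inner_smul_left]
        have h2 : ⟪u, g' - g⟫ ≤ 0 := by
          rw [inner_sub_right]; linarith [hg.2 g' hg'.1]
        have h3 := real_inner_le_norm v (g' - g)
        nlinarith
      refine ⟨g + s • v, hball ?_, ?_, ?_⟩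
      · rw [mem_ball, dist_eq_norm, add_sub_cancel_left, norm_smul, Real.norm_eq_abs,
          abs_of_nonneg (by rw [hs]; positivity)]
        refine lt_of_le_of_lt ?_ hgg
        have : s * ‖v‖ = ⟪u', g' - g⟫ / ‖v‖ := by rw [hs]; field_simp
        rw [this, div_le_iff₀ hvn]
        linarith
      · rw [inner_add_right, inner_smul_right, huv]; ring
      · rw [inner_add_right, inner_smul_right, hu'v', hs, inner_sub_right]
        field_simp
        ring
  obtain ⟨q, hqU, hqu, hqu'⟩ := hq
  obtain ⟨w, hw0, hwu, hwu'⟩ := exists_orth C.hn u u'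
  obtain ⟨s1, hs1, hx1⟩ := C.ray q hqU w hw0
  obtain ⟨s2, hs2, hx2⟩ := C.ray q hqU (-w) (neg_ne_zero.2 hw0)
  obtain ⟨y1, hy1⟩ := C.partner _ hx1
  obtain ⟨y2, hy2⟩ := C.partner _ hx2
  have a1 := hl g g1 _ y1 hg hg1 hy1 (by rw [inner_add_right, inner_smul_right, hwu, hqu]; ring)
  have a2 := hl g g1 _ y2 hg hg1 hy2 (by
    rw [inner_add_right, inner_smul_right, inner_neg_right, hwu, hqu]; ring)
  have b1 := hl' g' g1' _ y1 hg' hg1' hy1 (by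
    rw [inner_add_right, inner_smul_right, hwu', hqu']; ring)
  have b2 := hl' g' g1' _ y2 hg' hg1' hy2 (by
    rw [inner_add_right, inner_smul_right, inner_neg_right, hwu', hqu']; ring)
  have c1 : y1 - y2 = (-l * (s1 + s2)) • w := by
    rw [← sub_sub_sub_cancel_right y1 y2 g1, a1, a2]; module
  have c2 : y1 - y2 = (-l' * (s1 + s2)) • w := by
    rw [← sub_sub_sub_cancel_right y1 y2 g1', b1, b2]; module
  have c3 := smul_left_injective ℝ hw0 (c1.symm.trans c2)
  have : (s1 + s2) ≠ 0 := by positivity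
  have c4 := mul_right_cancel₀ this c3
  linarith

lemma Ctx.one {n : ℕ} {K L U : Set (Euc n)} (C : Ctx K L U) {u : Euc n} (hu : ‖u‖ = 1) :
    Good K L u 1 := by
  have hne : ∀ u : sphere (0 : Euc n) 1, (u : Euc n) ≠ 0 := fun u =>
    ne_zero_of_mem_unit_sphere u
  have hnorm : ∀ u : sphere (0 : Euc n) 1, ‖(u : Euc n)‖ = 1 := fun u =>
    norm_eq_of_mem_sphere u
  choose lam hpos hgood using fun u : sphere (0 : Euc n) 1 => C.good (hne u)
  have hlc : IsLocallyConstant lam := by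
    rw [IsLocallyConstant.iff_eventually_eq]
    intro a
    obtain ⟨η, hη, h⟩ := C.loc (hnorm a)
    rw [Metric.eventually_nhds_iff]
    refine ⟨η, hη, fun b hb => ?_⟩
    rw [Subtype.dist_eq, dist_eq_norm] at hb
    exact h b (hnorm b) hb _ _ (hgood a) (hgood b)
  have hps : PreconnectedSpace (sphere (0 : Euc n) 1) := by
    apply Subtype.preconnectedSpace
    apply isPreconnected_sphere
    rw [← Module.finrank_eq_rank, finrank_euclideanSpace_fin]
    have := C.hn
    exact_mod_cast (by omega : 1 < n)
  let a : sphere (0 : Euc n) 1 := ⟨u, by simpa using hu⟩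
  have hab : lam a = lam (-a) := hlc.apply_eq_of_preconnectedSpace a (-a)
  have hu0 : u ≠ 0 := hne a
  obtain ⟨g, hg⟩ := sup_exists C.body u
  obtain ⟨g', hg'⟩ := sup_exists C.body (-u)
  obtain ⟨v, hv0, huv, -⟩ := exists_orth C.hn u u
  obtain ⟨s, hs, hx⟩ := C.ray g (C.sub hg.1) v hv0
  obtain ⟨y, hy⟩ := C.partner _ hx
  have i0 : ⟪u, g + s • v⟫ = ⟪u, g⟫ := by rw [inner_add_right, inner_smul_right, huv]; ring
  have e1 := hgood a g g' _ y hg hg' hy i0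
  have e2 := hgood (-a) g' g y _ hg' (by simpa [a] using hg) hy.symm (by
    have := C.AB' hy hu0 hg hg' i0
    show ⟪-u, y⟫ = ⟪-u, g'⟫
    rw [inner_neg_left, inner_neg_left, this])
  rw [← hab, e1, add_sub_cancel_left, smul_smul, smul_smul] at e2
  have e3 := smul_left_injective ℝ hv0 e2
  have h4 : lam a * lam a = 1 := by
    have : s * (lam a * lam a - 1) = 0 := by linarith
    linarith [(mul_eq_zero.1 this).resolve_left hs.ne']
  have h5 : lam a = 1 := by nlinarith [hpos a]
  rw [← h5]
  exact hgood a

lemma graze_exists {n : ℕ} {K : Set (Euc n)} (hK : IsConvexBody K) {x z : Euc n} (hx : x ∉ K)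
    (hz : z ∈ supportCone K x) (hzK : z ∈ K) :
    ∃ u : Euc n, ‖u‖ = 1 ∧ Sup K u z ∧ ⟪u, x⟫ = ⟪u, z⟫ := by
  obtain ⟨hKc, hc, k0, hk0⟩ := hK
  obtain ⟨f, hf⟩ := exists_f K hKc hc x hx
  have hz' : z - x ∈ frontier (EC K x) := by rw [← mem_front]; simpa using hz
  have hsub : DC K x ⊆ EC K x := fun e he => (EC_iff K x e).2 (Or.inl he)
  have hcD : Convex ℝ (DC K x) := fun a ha b hb s t hs ht _ =>
    DC_add hc (DC_smul s hs ha) (DC_smul t ht hb)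
  have hni : z - x ∉ interior (DC K x) := fun h => hz'.2 (interior_mono hsub h)
  have hint : (interior (DC K x)).Nonempty := by
    refine ⟨k0 - x, ?_⟩
    have h1 : (Homeomorph.addLeft x) ⁻¹' (interior K) ⊆ interior (DC K x) := by
      apply interior_maximal
      · intro e he
        have he' : x + e ∈ K := interior_subset he
        exact ⟨1, zero_le_one, x + e, he', by simp⟩
      · exact isOpen_interior.preimage (Homeomorph.addLeft x).continuous
    apply h1
    simpa using hk0
  obtain ⟨φ, hφ⟩ := geometric_hahn_banach_open_point hcD.interior isOpen_interior hni
  have hle : ∀ d ∈ DC K x, φ d ≤ φ (z - x) := by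
    intro d hd
    have h1 : d ∈ closure (interior (DC K x)) := by
      rw [hcD.closure_interior_eq_closure_of_nonempty_interior hint]
      exact subset_closure hd
    have h2 : closure (interior (DC K x)) ⊆ {d | φ d ≤ φ (z - x)} :=
      closure_minimal (fun d hd => (hφ d hd).le) (isClosed_le φ.continuous continuous_const)
    exact h2 h1
  have hzD : z - x ∈ DC K x := ⟨1, zero_le_one, z, hzK, by simp⟩
  have h0 : φ (z - x) = 0 := by
    have h1 := hle _ (DC_smul 0 le_rfl hzD)
    have h2 := hle _ (DC_smul 2 (by norm_num) hzD)
    simp only [map_smul, smul_eq_mul] at h1 h2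
    linarith
  obtain ⟨u0, hu0⟩ : ∃ u0, u0 = (InnerProductSpace.toDual ℝ (Euc n)).symm φ := ⟨_, rfl⟩
  have hin : ∀ d, ⟪u0, d⟫ = φ d := fun d => by
    rw [hu0, InnerProductSpace.toDual_symm_apply]
  have hu00 : u0 ≠ 0 := by
    rintro rfl
    obtain ⟨d, hd⟩ := hint
    have := hφ d hd
    rw [← hin, ← hin, inner_zero_left, inner_zero_left] at this
    exact lt_irrefl _ this
  have hun : 0 < ‖u0‖ := norm_pos_iff.2 hu00
  have hxz : ⟪u0, x⟫ = ⟪u0, z⟫ := by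
    rw [← hin, inner_sub_right] at h0; linarith
  refine ⟨‖u0‖⁻¹ • u0, ?_, ⟨hzK, fun k hk => ?_⟩, ?_⟩
  · rw [norm_smul, norm_inv, norm_norm, inv_mul_cancel₀ hun.ne']
  · rw [real_inner_smul_left, real_inner_smul_left]
    have := hle (k - x) ⟨1, zero_le_one, k, hk, by simp⟩
    rw [h0, ← hin, inner_sub_right] at this
    gcongr
    linarith
  · rw [real_inner_smul_left, real_inner_smul_left, hxz]

lemma graze_mem {n : ℕ} {K : Set (Euc n)} (hK : IsConvexBody K) {x z u : Euc n} (hx : x ∉ K)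
    (hu : u ≠ 0) (hz : Sup K u z) (hxz : ⟪u, x⟫ = ⟪u, z⟫) : z ∈ supportCone K x ∩ frontier K := by
  obtain ⟨hKc, hc, k0, hk0⟩ := hK
  obtain ⟨f, hf⟩ := exists_f K hKc hc x hx
  refine ⟨?_, subset_closure hz.1, sup_not_int hu hz⟩
  have h1 : z - x ∈ frontier (EC K x) := by
    refine touch_lem hf hu ?_ ⟨1, zero_le_one, z, hz.1, by simp⟩ ?_ ?_
    · rintro e ⟨s, hs, k, hk, rfl⟩
      rw [inner_smul_right, inner_sub_right]
      have := hz.2 k hk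
      nlinarith
    · intro h
      exact hx (by rw [← sub_eq_zero.1 h]; exact hz.1)
    · rw [inner_sub_right]; linarith
  rw [← mem_front] at h1
  simpa using h1

lemma Ctx.fin {n : ℕ} {K L U : Set (Euc n)} (C : Ctx K L U) {x y z : Euc n} (h : CRel K L x y)
    (hz : z ∈ supportCone K x ∩ frontier K) : x + y - z ∈ supportCone K y ∩ frontier K := by
  have hx : x ∉ K := fun hh => C.disj x (C.sub hh) h.1
  have hy : y ∉ K := fun hh => C.disj y (C.sub hh) h.2.1
  obtain ⟨u, hu, hs, hxz⟩ := graze_exists C.body hx hz.1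
    (C.body.1.isClosed.frontier_subset hz.2)
  have hu0 : u ≠ 0 := by rintro rfl; simp at hu
  obtain ⟨g', hg'⟩ := sup_exists C.body (-u)
  have e := C.one hu z g' x y hs hg' h hxz
  have hg : x + y - z = g' := by
    have : g' = y - (-1 : ℝ) • (x - z) := by rw [← e]; abel
    rw [this]; module
  rw [hg]
  refine graze_mem C.body hy (neg_ne_zero.2 hu0) hg' ?_
  rw [inner_neg_left, inner_neg_left, C.AB' h hu0 hs hg' hxz]

/-- In the Setting, for all `x, y ∈ L` with `y ≠ x` such that
`C_y` is a translate of `C_x`, the grazes `Ω_x` and `Ω_y` are inversely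
homothetic with ratio `-1`. -/
theorem stmt_10 (n : ℕ) (hn : 3 ≤ n) (K L : Set (Euc n))
    (hK : IsConvexBody K) (hKs : StrictConvex ℝ K)
    (hL : IsSphereEmbeddingImage (n - 1) L)
    (hcomp : ∃ z ∈ Lᶜ, Bornology.IsBounded (connectedComponentIn Lᶜ z) ∧
      K ⊆ connectedComponentIn Lᶜ z)
    (hcone : ∀ x ∈ L, ∃ y ∈ L, y ≠ x ∧ ∃ p : Euc n,
      supportCone K y = (fun z => p + z) '' supportCone K x) :
    ∀ x ∈ L, ∀ y ∈ L, y ≠ x →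
      (∃ p : Euc n, supportCone K y = (fun z => p + z) '' supportCone K x) →
      ∃ c : Euc n, supportCone K y ∩ frontier K =
        (fun z => (2 : ℝ) • c - z) '' (supportCone K x ∩ frontier K) := by
  obtain ⟨z0, hz0, hbd, hKU⟩ := hcomp
  have hLc : IsClosed L := by
    obtain ⟨f, hf, -, rfl⟩ := hL
    exact (isCompact_range hf).isClosed
  have C : Ctx K L (connectedComponentIn Lᶜ z0) := by
    refine ⟨hn, hK, hKs, hLc.isOpen_compl.connectedComponentIn, hKU,
      fun x hx => connectedComponentIn_subset _ _ hx, ?_, ?_⟩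
    · intro q hq v hv
      by_contra hcon
      push Not at hcon
      have hqL : q ∉ L := connectedComponentIn_subset _ _ hq
      have hpre : IsPreconnected ((fun s : ℝ => q + s • v) '' Ici 0) :=
        isPreconnected_Ici.image _ (by fun_prop)
      have hsub : ((fun s : ℝ => q + s • v) '' Ici 0) ⊆ connectedComponentIn Lᶜ z0 := by
        rw [connectedComponentIn_eq hq]
        refine hpre.subset_connectedComponentIn ⟨0, by simp, by simp⟩ ?_
        rintro _ ⟨s, hs, rfl⟩
        rcases (mem_Ici.1 hs).eq_or_lt with h | h
        · simpa [← h] using hqL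
        · exact hcon s h
      obtain ⟨R, hR⟩ := (hbd.subset hsub).exists_norm_le
      have hvn : 0 < ‖v‖ := norm_pos_iff.2 hv
      have hR0 : 0 ≤ R := (norm_nonneg _).trans (hR _ ⟨0, by simp, rfl⟩)
      have h1 := hR _ ⟨(R + ‖q‖ + 1) / ‖v‖, by simp only [mem_Ici]; positivity, rfl⟩
      have h2 : ‖((R + ‖q‖ + 1) / ‖v‖) • v‖ = R + ‖q‖ + 1 := by
        rw [norm_smul, Real.norm_eq_abs, abs_of_nonneg (by positivity)]
        field_simp
      have h3 := norm_sub_le (q + ((R + ‖q‖ + 1) / ‖v‖) • v) q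
      rw [add_sub_cancel_left, h2] at h3
      simp only at h1
      linarith
    · intro x hx
      obtain ⟨y, hy, hyx, hp⟩ := hcone x hx
      exact ⟨y, hx, hy, hyx, hp⟩
  intro x hx y hy hyx hp
  have hr : CRel K L x y := ⟨hx, hy, hyx, hp⟩
  refine ⟨(1 / 2 : ℝ) • (x + y), ?_⟩
  have h2 : (2 : ℝ) • (1 / 2 : ℝ) • (x + y) = x + y := by rw [smul_smul]; norm_num
  rw [h2]
  ext z
  constructor
  · intro hz
    refine ⟨y + x - z, C.fin hr.symm hz, ?_⟩
    simp only
    abel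
  · rintro ⟨z', hz', rfl⟩
    exact C.fin hr hz'
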